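/- Let p ≥ 4 and c ≥ 2, and let C = {1, 2c}. Then for every n ≥ 1, N(n, p+2, C) ⊆ N(n, p, C). -/

import Mathlib

/-- The minimum excludant of a set of naturals. -/
noncomputable def mex (S : Set ℕ) : ℕ := sInf {v | v ∉ S}

/-- Fueled auxiliary for the Grundy sequence of CUT with cut-set `C`. -/
noncomputable def cutGAux (C : Finset ℕ) : ℕ → ℕ → ℕ
  | 0, _ => 0
  | fuel + 1, n =>
      mex {v | ∃ d ∈ C, ∃ l : List ℕ, l.length = d + 1 ∧ (∀ x ∈ l, 0 < x) ∧
            l.sum = n ∧ (l.map (cutGAux C fuel)).foldr (· ^^^ ·) 0 = v}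

/-- The Grundy (nim-value) sequence of the game CUT with cut-set `C`. -/
noncomputable def cutG (C : Finset ℕ) (n : ℕ) : ℕ := cutGAux C n n

/-- The nim-value of an option (a tuple of pile sizes). -/
noncomputable def nimVal (C : Finset ℕ) (l : List ℕ) : ℕ :=
  (l.map (cutG C)).foldr (· ^^^ ·) 0

/-- The nim-set `N(n, p, C)`. -/
def nimSet (n p : ℕ) (C : Finset ℕ) : Set ℕ :=
  {v | ∃ l : List ℕ, l.length = p ∧ (∀ x ∈ l, 0 < x) ∧ l.sum = n ∧ nimVal C l = v}

/-- The value of a pile of size `l + 1` with `l < 12 * c`, i.e. in the first period. -/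
def lowVal (c l : ℕ) : ℕ :=
  if l < 2 * c then l % 2
  else if l < 4 * c then 2 + l % 2
  else if l = 4 * c then 1
  else if l < 6 * c then 5 - l % 2
  else if l < 8 * c then 3 - l % 2
  else if l < 10 * c then 4 + l % 2
  else 6 + l % 2

/-- The value of a pile of size `m + 1`: the sequence has period `12 * c` and saltus `8`. -/
def pileVal (c m : ℕ) : ℕ := 8 * (m / (12 * c)) + lowVal c (m % (12 * c))

/-- The closed form of the Grundy sequence of CUT with cut-set `{1, 2 * c}`. -/
def closedForm (c n : ℕ) : ℕ := pileVal c (n - 1)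

/-- The coefficient of `c` in `weight`. -/
def weightSlope (y e : ℕ) : ℕ :=
  if e = 0 then [0, 0, 2, 2, 8, 8, 10, 10].getD y 0 else [4, 4, 6, 6, 4, 4, 6, 6].getD y 0

/-- The constant term of `weight`. -/
def weightConst (y e : ℕ) : ℕ :=
  if e = 0 then [0, 1, 0, 1, 0, 1, 0, 1].getD y 0 else [1, 0, 1, 0, 1, 2, 1, 2].getD y 0

/-- The least `M` of parity `y + e` such that `y < 8` is a nim-sum of values of piles
whose sizes, each decreased by one, add up to `M`. -/
def weight (c y e : ℕ) : ℕ := weightSlope y e * c + weightConst y e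

/-- The arithmetic condition characterising when `v` is the nim-sum of the values of at least four
piles whose sizes, each decreased by one, add up to `M`. -/
def Attainable (c v M : ℕ) : Prop := 12 * c * (v / 8) + weight c (v % 8) ((M + v) % 2) ≤ M

theorem xor_div_eight (a b : ℕ) : (a ^^^ b) / 8 = (a / 8) ^^^ (b / 8) :=
  Nat.xor_div_two_pow (n := 3)

theorem xor_mod_eight (a b : ℕ) : (a ^^^ b) % 8 = (a % 8) ^^^ (b % 8) :=
  Nat.xor_mod_two_pow (n := 3)

theorem xor_le_add (a b : ℕ) : a ^^^ b ≤ a + b := by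
  induction a using Nat.strong_induction_on generalizing b with
  | _ a ih =>
    rcases Nat.eq_zero_or_pos a with rfl | ha
    · simp
    · have h1 := ih (a / 2) (by omega) (b / 2)
      have h2 : (a ^^^ b) / 2 = (a / 2) ^^^ (b / 2) := Nat.xor_div_two_pow (n := 1)
      have h3 := Nat.xor_mod_two_eq (m := a) (n := b)
      omega

theorem xor_eight_mul_add (x y x' y' : ℕ) (hy : y < 8) (hy' : y' < 8) :
    (8 * x + y) ^^^ (8 * x' + y') = 8 * (x ^^^ x') + (y ^^^ y') := by
  have h1 := xor_div_eight (8 * x + y) (8 * x' + y')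
  have h2 := xor_mod_eight (8 * x + y) (8 * x' + y')
  rw [show (8 * x + y) / 8 = x by omega, show (8 * x' + y') / 8 = x' by omega] at h1
  rw [show (8 * x + y) % 8 = y by omega, show (8 * x' + y') % 8 = y' by omega] at h2
  omega

set_option maxHeartbeats 1000000 in
theorem lowVal_cases (c l : ℕ) :
    (lowVal c l = 0 ∧ l < 2 * c ∧ l % 2 = 0) ∨
    (lowVal c l = 1 ∧ l < 2 * c ∧ l % 2 = 1) ∨
    (lowVal c l = 2 ∧ 2 * c ≤ l ∧ l < 4 * c ∧ l % 2 = 0) ∨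
    (lowVal c l = 3 ∧ 2 * c ≤ l ∧ l < 4 * c ∧ l % 2 = 1) ∨
    (lowVal c l = 1 ∧ l = 4 * c) ∨
    (lowVal c l = 4 ∧ 4 * c < l ∧ l < 6 * c ∧ l % 2 = 1) ∨
    (lowVal c l = 5 ∧ 4 * c < l ∧ l < 6 * c ∧ l % 2 = 0) ∨
    (lowVal c l = 3 ∧ 6 * c ≤ l ∧ l < 8 * c ∧ l % 2 = 0) ∨
    (lowVal c l = 2 ∧ 6 * c ≤ l ∧ l < 8 * c ∧ l % 2 = 1) ∨
    (lowVal c l = 4 ∧ 8 * c ≤ l ∧ l < 10 * c ∧ l % 2 = 0) ∨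
    (lowVal c l = 5 ∧ 8 * c ≤ l ∧ l < 10 * c ∧ l % 2 = 1) ∨
    (lowVal c l = 6 ∧ 10 * c ≤ l ∧ l % 2 = 0) ∨
    (lowVal c l = 7 ∧ 10 * c ≤ l ∧ l % 2 = 1) := by
  unfold lowVal
  rcases Nat.mod_two_eq_zero_or_one l with hp | hp <;> rw [hp] <;> split_ifs <;> simp <;> omega

theorem lowVal_lt (c l : ℕ) : lowVal c l < 8 := by
  unfold lowVal
  split_ifs <;> omega

theorem pileVal_add (c k l : ℕ) (hl : l < 12 * c) :
    pileVal c (12 * c * k + l) = 8 * k + lowVal c l := by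
  have hc : 0 < 12 * c := by omega
  rw [pileVal, Nat.mul_add_div hc, Nat.div_eq_of_lt hl, Nat.mul_add_mod, Nat.mod_eq_of_lt hl,
    Nat.add_zero]

theorem exists_period (c m : ℕ) (hc : 0 < c) : ∃ k l, l < 12 * c ∧ m = 12 * c * k + l :=
  ⟨m / (12 * c), m % (12 * c), Nat.mod_lt _ (by omega), (Nat.div_add_mod _ _).symm⟩

theorem weight_tables_subadditive : ∀ y < 8, ∀ y' < 8, ∀ e < 2, ∀ e' < 2,
    weightSlope (y ^^^ y') ((e + e') % 2) ≤ weightSlope y e + weightSlope y' e' ∧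
    2 * weightSlope (y ^^^ y') ((e + e') % 2) + weightConst (y ^^^ y') ((e + e') % 2) ≤
      2 * (weightSlope y e + weightSlope y' e') + (weightConst y e + weightConst y' e') := by
  decide

theorem weight_xor_le (c y y' e e' : ℕ) (hc : 2 ≤ c) (hy : y < 8) (hy' : y' < 8)
    (he : e < 2) (he' : e' < 2) :
    weight c (y ^^^ y') ((e + e') % 2) ≤ weight c y e + weight c y' e' := by
  obtain ⟨h1, h2⟩ := weight_tables_subadditive y hy y' hy' e he e' he'
  obtain ⟨k, rfl⟩ := Nat.exists_eq_add_of_le hc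
  unfold weight
  nlinarith [Nat.mul_le_mul_right k h1]

theorem Attainable.xor {c v v' M M' : ℕ} (hc : 2 ≤ c) (h : Attainable c v M)
    (h' : Attainable c v' M') : Attainable c (v ^^^ v') (M + M') := by
  unfold Attainable at *
  have h1 := weight_xor_le c (v % 8) (v' % 8) ((M + v) % 2) ((M' + v') % 2) hc
    (Nat.mod_lt _ (by norm_num)) (Nat.mod_lt _ (by norm_num)) (Nat.mod_lt _ (by norm_num))
    (Nat.mod_lt _ (by norm_num))
  have h2 := Nat.xor_mod_two_eq (m := v) (n := v')
  have h3 : ((M + v) % 2 + (M' + v') % 2) % 2 = (M + M' + (v ^^^ v')) % 2 := by omega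
  rw [h3] at h1
  rw [xor_div_eight, xor_mod_eight]
  have h4 := Nat.mul_le_mul_left (12 * c) (xor_le_add (v / 8) (v' / 8))
  rw [Nat.mul_add] at h4
  omega

theorem Attainable.mono {c v M M' : ℕ} (h : Attainable c v M) (hM : M ≤ M')
    (hpar : M % 2 = M' % 2) : Attainable c v M' := by
  unfold Attainable at *
  rw [show (M' + v) % 2 = (M + v) % 2 by omega]
  omega

theorem weight_lowVal (c l : ℕ) (hl : l < 12 * c) :
    weight c (lowVal c l) ((l + lowVal c l) % 2) ≤ l ∧
      l < 2 * c + weight c (lowVal c l) ((l + lowVal c l) % 2) := by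
  have hp := Nat.mod_two_eq_zero_or_one l
  rcases lowVal_cases c l with h | h | h | h | h | h | h | h | h | h | h | h | h <;>
  rcases hp with hp | hp <;>
  first
  | omega
  | (rw [h.1]; simp [Nat.add_mod, hp, weight, weightSlope, weightConst]; omega)

theorem attainable_pileVal (c m : ℕ) (hc : 2 ≤ c) : Attainable c (pileVal c m) m := by
  obtain ⟨k, l, hl, rfl⟩ := exists_period c m (by omega)
  rw [pileVal_add c k l hl]
  have h1 := lowVal_lt c l
  have h2 := (weight_lowVal c l hl).1
  have h3 : 12 * c * k = 12 * (c * k) := by ring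
  unfold Attainable
  rw [show (8 * k + lowVal c l) / 8 = k by omega,
    show (8 * k + lowVal c l) % 8 = lowVal c l by omega,
    show (12 * c * k + l + (8 * k + lowVal c l)) % 2 = (l + lowVal c l) % 2 by omega]
  omega

theorem not_attainable_pileVal (c m : ℕ) (hc : 2 ≤ c) (hm : 2 * c ≤ m) :
    ¬ Attainable c (pileVal c m) (m - 2 * c) := by
  obtain ⟨k, l, hl, rfl⟩ := exists_period c m (by omega)
  rw [pileVal_add c k l hl]
  have h1 := lowVal_lt c l
  have h2 := (weight_lowVal c l hl).2
  have h3 : 12 * c * k = 12 * (c * k) := by ring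
  unfold Attainable
  rw [show (8 * k + lowVal c l) / 8 = k by omega,
    show (8 * k + lowVal c l) % 8 = lowVal c l by omega,
    show (12 * c * k + l - 2 * c + (8 * k + lowVal c l)) % 2 = (l + lowVal c l) % 2 by omega]
  omega

theorem exists_pair_of_weight (c y e : ℕ) (hc : 2 ≤ c) (hy : y < 8) (he : e < 2) :
    ∃ a b, a < 12 * c ∧ b < 12 * c ∧ a + b = weight c y e ∧ lowVal c a ^^^ lowVal c b = y := by
  have key : ∀ a b u w, lowVal c a = u → lowVal c b = w → a < 12 * c → b < 12 * c →
      a + b = weight c y e → u ^^^ w = y →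
      ∃ a b, a < 12 * c ∧ b < 12 * c ∧ a + b = weight c y e ∧ lowVal c a ^^^ lowVal c b = y := by
    rintro a b u w rfl rfl ha hb hab h
    exact ⟨a, b, ha, hb, hab, h⟩
  have low0 : lowVal c 0 = 0 := by unfold lowVal; split_ifs <;> omega
  have low1 : lowVal c 1 = 1 := by unfold lowVal; split_ifs <;> omega
  have low2 : lowVal c (2 * c) = 2 := by unfold lowVal; split_ifs <;> omega
  have low3 : lowVal c (2 * c + 1) = 3 := by unfold lowVal; split_ifs <;> omega
  have low4 : lowVal c (4 * c + 1) = 4 := by unfold lowVal; split_ifs <;> omega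
  have single : lowVal c (weight c y e) = y → weight c y e < 12 * c →
      ∃ a b, a < 12 * c ∧ b < 12 * c ∧ a + b = weight c y e ∧ lowVal c a ^^^ lowVal c b = y :=
    fun h hw => key _ 0 _ _ h low0 hw (by omega) rfl (by simp)
  have hw : weight c y e < 12 * c := by
    interval_cases y <;> interval_cases e <;> simp [weight, weightSlope, weightConst] <;> omega
  rcases (show e = 0 ∨ e = 1 by omega) with rfl | rfl
  · refine single ?_ hw
    interval_cases y <;> simp only [weight, weightSlope, weightConst, lowVal] <;> simp <;>
      split_ifs <;> omega
  · interval_cases y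
    · exact key (4 * c) 1 1 1 (by unfold lowVal; split_ifs <;> omega) low1 (by omega) (by omega)
        rfl rfl
    · exact single (by simp [weight, weightSlope, weightConst, lowVal]; omega) hw
    · exact single (by simp [weight, weightSlope, weightConst, lowVal]; split_ifs <;> omega) hw
    · exact single (by simp [weight, weightSlope, weightConst, lowVal]; split_ifs <;> omega) hw
    · exact single (by simp [weight, weightSlope, weightConst, lowVal]; split_ifs <;> omega) hw
    · exact single (by simp [weight, weightSlope, weightConst, lowVal]; split_ifs <;> omega) hw
    · exact key (4 * c + 1) (2 * c) 4 2 low4 low2 (by omega) (by omega)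
        (by simp [weight, weightSlope, weightConst]; ring) rfl
    · exact key (4 * c + 1) (2 * c + 1) 4 3 low4 low3 (by omega) (by omega)
        (by simp [weight, weightSlope, weightConst]; ring) rfl

theorem weight_mod_two (c y e : ℕ) (hy : y < 8) (he : e < 2) :
    weight c y e % 2 = (y + e) % 2 := by
  interval_cases y <;> interval_cases e <;> simp [weight, weightSlope, weightConst] <;> omega

theorem Attainable.exists_piles {c v M : ℕ} (hc : 2 ≤ c) (h : Attainable c v M) :
    ∃ a b j, a + b + 2 * j = M ∧ pileVal c a ^^^ pileVal c b = v := by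
  have he : (M + v) % 2 < 2 := Nat.mod_lt _ (by norm_num)
  have hy : v % 8 < 8 := Nat.mod_lt _ (by norm_num)
  obtain ⟨a, b, ha, hb, hab, hv⟩ := exists_pair_of_weight c (v % 8) ((M + v) % 2) hc hy he
  have hpar := weight_mod_two c (v % 8) ((M + v) % 2) hy he
  unfold Attainable at h
  have h3 : 12 * c * (v / 8) = 12 * (c * (v / 8)) := by ring
  refine ⟨12 * c * (v / 8) + a, b, (M - (12 * c * (v / 8) + (a + b))) / 2, by omega, ?_⟩
  have hb' : pileVal c b = 8 * 0 + lowVal c b := by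
    simpa using pileVal_add c 0 b hb
  rw [pileVal_add c _ a ha, hb', xor_eight_mul_add _ _ _ _ (lowVal_lt c a) (lowVal_lt c b), hv]
  simp only [Nat.xor_zero]
  omega

set_option maxHeartbeats 1000000 in
theorem lowVal_xor_ne (c l a b : ℕ) (hl : l < 12 * c) (hab : a + b + 1 = l) :
    lowVal c a ^^^ lowVal c b ≠ lowVal c l := by
  intro h
  rcases lowVal_cases c a with
    ha | ha | ha | ha | ha | ha | ha | ha | ha | ha | ha | ha | ha <;>
  rcases lowVal_cases c b with
    hb | hb | hb | hb | hb | hb | hb | hb | hb | hb | hb | hb | hb <;>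
  first
  | omega
  | (rw [ha.1, hb.1] at h
     simp only [Nat.reduceXor] at h
     unfold lowVal at h
     split_ifs at h <;> omega)

theorem pileVal_xor_ne (c m a b : ℕ) (hc : 0 < c) (hab : a + b + 1 = m) :
    pileVal c a ^^^ pileVal c b ≠ pileVal c m := by
  obtain ⟨k, l, hl, rfl⟩ := exists_period c m hc
  obtain ⟨i, a, ha, rfl⟩ := exists_period c a hc
  obtain ⟨j, b, hb, rfl⟩ := exists_period c b hc
  rw [pileVal_add c k l hl, pileVal_add c i a ha, pileVal_add c j b hb,
    xor_eight_mul_add _ _ _ _ (lowVal_lt c a) (lowVal_lt c b)]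
  intro h
  have h1 := Nat.xor_lt_two_pow (n := 3) (lowVal_lt c a) (lowVal_lt c b)
  have h2 := lowVal_lt c l
  have hk : i ^^^ j = k := by omega
  obtain ⟨t, ht⟩ := Nat.exists_eq_add_of_le (hk ▸ xor_le_add i j)
  have h3 : 12 * c * i + 12 * c * j = 12 * c * k + 12 * c * t := by
    rw [← Nat.mul_add, ht, Nat.mul_add]
  refine lowVal_xor_ne c l a b hl ?_ (by omega)
  rcases Nat.eq_zero_or_pos t with rfl | h_t
  · omega
  · have := Nat.le_mul_of_pos_right (12 * c) h_t
    omega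

set_option maxHeartbeats 1000000 in
theorem exists_pair_of_lt_lowVal (c l v : ℕ) (hc : 2 ≤ c) (hl : l < 12 * c) (hv : v < lowVal c l)
    (hw : l < 2 * c + weight c v ((l + v) % 2)) :
    ∃ a b, a + b + 1 = l ∧ lowVal c a ^^^ lowVal c b = v := by
  have key : ∀ a u, lowVal c a = u → lowVal c (l - 1 - a) = u ^^^ v → a + 1 ≤ l →
      ∃ a b, a + b + 1 = l ∧ lowVal c a ^^^ lowVal c b = v := by
    rintro a u rfl h ha
    exact ⟨a, l - 1 - a, by omega, by rw [h, ← Nat.xor_assoc, Nat.xor_self, Nat.zero_xor]⟩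
  have low0 : lowVal c 0 = 0 := by unfold lowVal; split_ifs <;> omega
  have low1 : lowVal c (2 * c - 1) = 1 := by unfold lowVal; split_ifs <;> omega
  have low2 : lowVal c (2 * c) = 2 := by unfold lowVal; split_ifs <;> omega
  have hp := Nat.mod_two_eq_zero_or_one l
  rcases lowVal_cases c l with h | h | h | h | h | h | h | h | h | h | h | h | h <;>
  rcases hp with hp | hp <;>
  first
  | omega
  | (rw [h.1] at hv
     interval_cases v <;> simp [Nat.add_mod, hp, weight, weightSlope, weightConst] at hw <;>
     first
     | omega
     | (refine key 0 0 low0 ?_ ?_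
        · simp only [Nat.reduceXor]
          unfold lowVal
          split_ifs <;> omega
        · omega)
     | (refine key (2 * c - 1) 1 low1 ?_ ?_
        · simp only [Nat.reduceXor]
          unfold lowVal
          split_ifs <;> omega
        · omega)
     | (refine key (2 * c) 2 low2 ?_ ?_
        · simp only [Nat.reduceXor]
          unfold lowVal
          split_ifs <;> omega
        · omega))

theorem weight_le (c y e : ℕ) (hc : 2 ≤ c) (hy : y < 8) (he : e < 2) :
    weight c y e ≤ 10 * c + (y + e) % 2 := by
  interval_cases y <;> interval_cases e <;> simp [weight, weightSlope, weightConst] <;> omega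

theorem exists_option_of_lt_pileVal (c m v : ℕ) (hc : 2 ≤ c) (hv : v < pileVal c m) :
    (∃ a b, a + b + 1 = m ∧ pileVal c a ^^^ pileVal c b = v) ∨
      (2 * c ≤ m ∧ Attainable c v (m - 2 * c)) := by
  obtain ⟨k, l, hl, rfl⟩ := exists_period c m (by omega)
  rw [pileVal_add c k l hl] at hv
  have h8 := lowVal_lt c l
  have hy : v % 8 < 8 := Nat.mod_lt _ (by norm_num)
  have he : (l + v % 8) % 2 < 2 := Nat.mod_lt _ (by norm_num)
  have hk : 12 * c * k = 12 * (c * k) := by ring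
  unfold Attainable
  rcases Nat.lt_or_ge (v / 8) k with hlt | hge
  · right
    obtain ⟨t, rfl⟩ := Nat.exists_eq_add_of_lt hlt
    have h1 := weight_le c (v % 8) ((l + v % 8) % 2) hc hy he
    have h2 : 12 * c * (v / 8 + t + 1) = 12 * c * (v / 8) + 12 * c * t + 12 * c := by ring
    have h3 : 2 * c ≤ 12 * c * (v / 8 + t + 1) + l := by omega
    refine ⟨h3, ?_⟩
    rw [show (12 * c * (v / 8 + t + 1) + l - 2 * c + v) % 2 = (l + v % 8) % 2 by omega]
    omega
  · have hvk : v / 8 = k := by omega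
    by_cases hw : l < 2 * c + weight c (v % 8) ((l + v % 8) % 2)
    · left
      obtain ⟨a, b, hab, h⟩ := exists_pair_of_lt_lowVal c l (v % 8) hc hl (by omega) hw
      refine ⟨12 * c * k + a, b, by omega, ?_⟩
      have hb' : pileVal c b = 8 * 0 + lowVal c b := by
        simpa using pileVal_add c 0 b (by omega)
      rw [pileVal_add c _ a (by omega), hb',
        xor_eight_mul_add _ _ _ _ (lowVal_lt c a) (lowVal_lt c b), h]
      simp only [Nat.xor_zero]
      omega
    · right
      refine ⟨by omega, ?_⟩
      rw [hvk, show (12 * c * k + l - 2 * c + v) % 2 = (l + v % 8) % 2 by omega]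
      omega

theorem attainable_of_list (c : ℕ) (hc : 2 ≤ c) (l : List ℕ) (hl : ∀ x ∈ l, 0 < x) :
    l.length ≤ l.sum ∧
      Attainable c ((l.map (closedForm c)).foldr (· ^^^ ·) 0) (l.sum - l.length) := by
  induction l with
  | nil => simp [Attainable, weight, weightSlope, weightConst]
  | cons x l ih =>
    obtain ⟨h1, h2⟩ := ih fun y hy => hl y (List.mem_cons_of_mem _ hy)
    have hx := hl x List.mem_cons_self
    have h3 := (attainable_pileVal c (x - 1) hc).xor hc h2
    simp only [List.sum_cons, List.length_cons, List.map_cons, List.foldr_cons]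
    refine ⟨by omega, ?_⟩
    rwa [show x + l.sum - (l.length + 1) = x - 1 + (l.sum - l.length) by omega]

theorem foldr_replicate_one (c q : ℕ) (hc : 0 < c) :
    ((List.replicate q 1).map (closedForm c)).foldr (· ^^^ ·) 0 = 0 := by
  have h : closedForm c 1 = 0 := by
    simp [closedForm, pileVal, lowVal, hc]
  induction q with
  | zero => rfl
  | succ q ih => simpa [List.replicate_succ, h] using ih

theorem Attainable.exists_list {c v n p : ℕ} (hc : 2 ≤ c) (hp : 4 ≤ p) (hn : p ≤ n)
    (h : Attainable c v (n - p)) :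
    ∃ l : List ℕ, l.length = p ∧ (∀ x ∈ l, 0 < x) ∧ l.sum = n ∧
      (l.map (closedForm c)).foldr (· ^^^ ·) 0 = v := by
  obtain ⟨a, b, j, hM, hv⟩ := h.exists_piles hc
  refine ⟨(a + 1) :: (b + 1) :: (j + 1) :: (j + 1) :: List.replicate (p - 4) 1, ?_, ?_, ?_, ?_⟩
  · simp
    omega
  · simp
  · simp
    omega
  · simp only [List.map_cons, List.foldr_cons, foldr_replicate_one c (p - 4) (by omega)]
    simp [closedForm, hv]

theorem mex_eq {S : Set ℕ} {g : ℕ} (hg : g ∉ S) (h : ∀ v < g, v ∈ S) : mex S = g := by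
  refine le_antisymm (Nat.sInf_le hg) (le_csInf ⟨g, hg⟩ fun v hv => ?_)
  by_contra! hlt
  exact hv (h v hlt)

theorem lt_of_mem_of_two_le_length {l : List ℕ} (hl : ∀ x ∈ l, 0 < x) (hlen : 2 ≤ l.length)
    {x : ℕ} (hx : x ∈ l) : x < l.sum := by
  obtain ⟨s, t, rfl⟩ := List.append_of_mem hx
  have key : ∀ r : List ℕ, (∀ x ∈ r, 0 < x) → r.length ≤ r.sum := by
    intro r hr
    induction r with
    | nil => simp
    | cons y r ih =>
      have h1 := hr y List.mem_cons_self
      have h2 := ih fun z hz => hr z (List.mem_cons_of_mem _ hz)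
      simp only [List.length_cons, List.sum_cons]
      omega
  have hs := key s fun y hy => hl y (by simp [hy])
  have ht := key t fun y hy => hl y (by simp [hy])
  simp only [List.length_append, List.length_cons, List.sum_append, List.sum_cons] at *
  omega

theorem cutGAux_eq_closedForm (c : ℕ) (hc : 2 ≤ c) (fuel n : ℕ) (hn : 1 ≤ n) (hf : n ≤ fuel) :
    cutGAux {1, 2 * c} fuel n = closedForm c n := by
  induction fuel generalizing n with
  | zero => omega
  | succ fuel ih =>
    have hmap : ∀ l : List ℕ, (∀ x ∈ l, 0 < x) → 2 ≤ l.length → l.sum = n →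
        l.map (cutGAux {1, 2 * c} fuel) = l.map (closedForm c) := by
      intro l hl hlen hsum
      refine List.map_congr_left fun x hx => ih x (hl x hx) ?_
      have := lt_of_mem_of_two_le_length hl hlen hx
      omega
    rw [cutGAux]
    apply mex_eq
    · rintro ⟨d, hd, l, hlen, hl, hsum, hv⟩
      simp only [Finset.mem_insert, Finset.mem_singleton] at hd
      rw [hmap l hl (by omega) hsum] at hv
      rcases hd with rfl | rfl
      · obtain ⟨a, b, rfl⟩ := List.length_eq_two.mp hlen
        simp only [List.mem_cons, List.not_mem_nil, or_false, forall_eq_or_imp, forall_eq,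
          List.sum_cons, List.sum_nil, List.map_cons, List.map_nil, List.foldr_cons,
          List.foldr_nil, Nat.xor_zero] at hl hsum hv
        exact pileVal_xor_ne c (n - 1) (a - 1) (b - 1) (by omega) (by omega) hv
      · obtain ⟨h1, h2⟩ := attainable_of_list c hc l hl
        rw [hv, hlen, hsum, show n - (2 * c + 1) = n - 1 - 2 * c by omega] at h2
        exact not_attainable_pileVal c (n - 1) hc (by omega) h2
    · intro v hv
      rcases exists_option_of_lt_pileVal c (n - 1) v hc hv with ⟨a, b, hab, h⟩ | ⟨hle, h⟩
      · have hl : ∀ x ∈ [a + 1, b + 1], 0 < x := by simp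
        have hsum : [a + 1, b + 1].sum = n := by simp; omega
        refine ⟨1, by simp, [a + 1, b + 1], rfl, hl, hsum, ?_⟩
        rw [hmap _ hl le_rfl hsum]
        simpa [closedForm] using h
      · rw [show n - 1 - 2 * c = n - (2 * c + 1) by omega] at h
        obtain ⟨l, hlen, hl, hsum, h⟩ := h.exists_list hc (by omega) (by omega)
        refine ⟨2 * c, by simp, l, hlen, hl, hsum, ?_⟩
        rwa [hmap l hl (by omega) hsum]

theorem nimVal_eq (c : ℕ) (hc : 2 ≤ c) (l : List ℕ) (hl : ∀ x ∈ l, 0 < x) :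
    nimVal {1, 2 * c} l = (l.map (closedForm c)).foldr (· ^^^ ·) 0 := by
  rw [nimVal]
  congr 1
  exact List.map_congr_left fun x hx => cutGAux_eq_closedForm c hc x x (hl x hx) le_rfl

/-- For `p ≥ 4` and `c ≥ 2`, `N(n, p+2, {1, 2c}) ⊆ N(n, p, {1, 2c})`. -/
theorem nimSet_subset (p : ℕ) (hp : 4 ≤ p) (c : ℕ) (hc : 2 ≤ c)
    (n : ℕ) (hn : 1 ≤ n) :
    nimSet n (p + 2) {1, 2*c} ⊆ nimSet n p {1, 2*c} := by
  rintro v ⟨l, hlen, hl, hsum, hv⟩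
  rw [nimVal_eq c hc l hl] at hv
  obtain ⟨h1, h2⟩ := attainable_of_list c hc l hl
  rw [hv, hlen, hsum] at h2
  obtain ⟨l', hlen', hl', hsum', hv'⟩ :=
    (h2.mono (M' := n - p) (by omega) (by omega)).exists_list hc hp (by omega)
  exact ⟨l', hlen', hl', hsum', by rwa [nimVal_eq c hc l' hl']⟩
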